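/- In the roommates model, lcs(𝒞) equals the intersection, over all nonempty F ∈ 𝓕, of {x ∈ ℝ_{≥0}^{I×I} : Σ_{(i,j)∈F} x_{i,j} ≤ k_F} with the intersection, over all i ∈ I and J ∈ 𝓙_i, of {x ∈ ℝ_{≥0}^{I×I} : Σ_{(i',j')∈J} x_{i',j'} ≤ 1}. -/

import Mathlib

open Finset

/-- The matching number of the graph `G_F` on `I` whose edges are the (unordered versions
of the) pairs in `F`: the maximum cardinality of a set of pairwise vertex-disjoint edges,
computed as the maximum cardinality of a subset of `F` whose members are pairwise
vertex-disjoint. -/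
noncomputable def kF {I : Type*} [Fintype I] [DecidableEq I] (F : Finset (I × I)) : ℕ := by
  classical
  exact Finset.sup
    (Finset.filter
      (fun M : Finset (I × I) => (M : Set (I × I)).Pairwise fun e e' =>
        e.1 ≠ e'.1 ∧ e.1 ≠ e'.2 ∧ e.2 ≠ e'.1 ∧ e.2 ≠ e'.2)
      F.powerset)
    Finset.card

/-- The set of (deterministic) matchings in the roommates model: symmetric 0-1 matrices
whose rows sum to one. -/
def MatchSet (I : Type*) [Fintype I] : Set (I → I → ℝ) :=
  {x | (∀ i j, x i j = 0 ∨ x i j = 1) ∧ (∀ i j, x i j = x j i) ∧ ∀ i, ∑ j, x i j = 1}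

/-- For involutions `M`, `N` and a fixed point `t` of `N`, the orbit of `t` under `M` and `N`
contains at most one fixed point of `M`. -/
lemma exists_invariant_set {I : Type*} {M N : I → I} (hM : Function.Involutive M)
    (hN : Function.Involutive N) {t u v : I} (ht : N t = t) (hu : M u = u) (hv : M v = v)
    (huv : u ≠ v) :
    ∃ C : Set I, t ∈ C ∧ (∀ i, M i ∈ C ↔ i ∈ C) ∧ (∀ i, N i ∈ C ↔ i ∈ C) ∧ (u ∉ C ∨ v ∉ C) := by
  set m : Equiv.Perm I := hM.toPerm with hm
  set n : Equiv.Perm I := hN.toPerm with hn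
  have hmm : m * m = 1 := by ext i; exact hM i
  have hnn : n * n = 1 := by ext i; exact hN i
  have hmi : m⁻¹ = m := inv_eq_of_mul_eq_one_left hmm
  have hni : n⁻¹ = n := inv_eq_of_mul_eq_one_left hnn
  set r : Equiv.Perm I := m * n with hr
  have hconj : n * r * n⁻¹ = r⁻¹ := by
    rw [hr, mul_inv_rev, hmi, hni, mul_assoc, mul_assoc, hnn, mul_one]
  have hnr : ∀ k : ℤ, n ((r ^ k) t) = (r ^ (-k)) t := by
    intro k
    have h : n * r ^ k = r ^ (-k) * n := by
      rw [zpow_neg, ← inv_zpow, ← hconj, conj_zpow]; group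
    have := congrArg (fun p : Equiv.Perm I => p t) h
    simp only [Equiv.Perm.mul_apply] at this
    rw [this]; congr 1
  have hmr : ∀ k : ℤ, m ((r ^ k) t) = (r ^ (1 - k)) t := by
    intro k
    have h : m = r * n := by rw [hr, mul_assoc, hnn, mul_one]
    rw [sub_eq_add_neg, zpow_add, zpow_one, Equiv.Perm.mul_apply, ← hnr, ← Equiv.Perm.mul_apply r,
      ← h]
  have hMC : ∀ i, (∃ k : ℤ, (r ^ k) t = i) → ∃ k : ℤ, (r ^ k) t = M i := by
    rintro _ ⟨k, rfl⟩; exact ⟨1 - k, (hmr k).symm⟩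
  have hNC : ∀ i, (∃ k : ℤ, (r ^ k) t = i) → ∃ k : ℤ, (r ^ k) t = N i := by
    rintro _ ⟨k, rfl⟩; exact ⟨-k, (hnr k).symm⟩
  refine ⟨{i | ∃ k : ℤ, (r ^ k) t = i}, ⟨0, by simp⟩, fun i => ⟨fun h => ?_, hMC i⟩,
    fun i => ⟨fun h => ?_, hNC i⟩, ?_⟩
  · have := hMC _ h; rwa [hM i] at this
  · have := hNC _ h; rwa [hN i] at this
  · by_contra! hcon
    simp only [Set.mem_ofPred_eq] at hcon
    obtain ⟨⟨a, ha⟩, ⟨b, hb⟩⟩ := hcon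
    have key : ∀ (a : ℤ) (i : I), M i = i → (r ^ a) t = i →
        r ^ (2 * a - 1) ∈ MulAction.stabilizer (Equiv.Perm I) t := by
      intro a i hi hai
      have h1 : (r ^ (1 - a)) t = (r ^ a) t := by
        rw [← hmr, hai]; exact hi
      rw [MulAction.mem_stabilizer_iff, Equiv.Perm.smul_def]
      have : 2 * a - 1 = -(1 - a) + a := by ring
      rw [this, zpow_add, Equiv.Perm.mul_apply, ← h1, ← Equiv.Perm.mul_apply, ← zpow_add]
      simp
    have h1 := key a u hu ha
    have h2 := key b v hv hb
    have h3 : r ^ (a - b) ∈ MulAction.stabilizer (Equiv.Perm I) t := by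
      have e : a - b = (2 * a - 1) * (1 - b) - (2 * b - 1) * (1 - a) := by ring
      rw [e, zpow_sub, zpow_mul, zpow_mul]
      exact Subgroup.mul_mem _ (Subgroup.zpow_mem _ h1 _)
        (Subgroup.inv_mem _ (Subgroup.zpow_mem _ h2 _))
    rw [MulAction.mem_stabilizer_iff, Equiv.Perm.smul_def] at h3
    apply huv
    rw [← ha, ← hb]
    have : a = b + (a - b) := by ring
    rw [this, zpow_add, Equiv.Perm.mul_apply, h3]

/-- From a maximum-weight matching missing `t` and one missing both `u` and `v`, exchange along an
invariant set yields a maximum-weight matching missing `t` and one of `u`, `v`. -/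
lemma exists_maximal_fixing_both {I : Type*} [Fintype I] {w : I → I → ℝ} {c : ℝ}
    (hle : ∀ σ : I → I, Function.Involutive σ → ∑ i, w i (σ i) ≤ c)
    {M N : I → I} (hM : Function.Involutive M) (hN : Function.Involutive N)
    (hMs : ∀ i, M i ≠ i → 0 < w i (M i)) (hNs : ∀ i, N i ≠ i → 0 < w i (N i))
    (hMc : ∑ i, w i (M i) = c) (hNc : ∑ i, w i (N i) = c)
    {t u v : I} (ht : N t = t) (hu : M u = u) (hv : M v = v) (huv : u ≠ v) :
    ∃ σ : I → I, Function.Involutive σ ∧ (∀ i, σ i ≠ i → 0 < w i (σ i)) ∧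
      ∑ i, w i (σ i) = c ∧ σ t = t ∧ (σ u = u ∨ σ v = v) := by
  classical
  obtain ⟨C, htC, hMC, hNC, hC⟩ := exists_invariant_set hM hN ht hu hv huv
  have hσ : Function.Involutive fun i => if i ∈ C then N i else M i := by
    intro i
    by_cases h : i ∈ C
    · simp [h, (hNC i).2 h, hN i]
    · simp [h, hMC i, hM i]
  have hτ : Function.Involutive fun i => if i ∈ C then M i else N i := by
    intro i
    by_cases h : i ∈ C
    · simp [h, (hMC i).2 h, hM i]
    · simp [h, hNC i, hN i]
  refine ⟨fun i => if i ∈ C then N i else M i, hσ, ?_, ?_, ?_, ?_⟩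
  · intro i
    by_cases h : i ∈ C
    · simpa [h] using hNs i
    · simpa [h] using hMs i
  · have h1 := hle _ hσ
    have h2 := hle _ hτ
    have h3 : ∑ i, w i (if i ∈ C then N i else M i) + ∑ i, w i (if i ∈ C then M i else N i)
        = c + c := by
      nth_rewrite 1 [← hMc]
      rw [← hNc, ← sum_add_distrib, ← sum_add_distrib]
      refine sum_congr rfl fun i _ => ?_
      by_cases h : i ∈ C <;> simp [h, add_comm]
    simp only at h1 h2 ⊢
    linarith
  · simp [htC, ht]
  · rcases hC with h | h
    · left; simp [h, hu]
    · right; simp [h, hv]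

/-- Dropping the edges of nonpositive weight from an involution. -/
lemma exists_supported_involution {I : Type*} [Fintype I] {w : I → I → ℝ}
    (hsymm : ∀ i j, w i j = w j i) (hdiag : ∀ i, w i i = 0) {σ : I → I}
    (hσ : Function.Involutive σ) :
    ∃ τ : I → I, Function.Involutive τ ∧ (∀ i, τ i ≠ i → 0 < w i (τ i)) ∧
      ∑ i, w i (τ i) = ∑ i, max 0 (w i (σ i)) := by
  classical
  refine ⟨fun i => if 0 < w i (σ i) then σ i else i, ?_, ?_, ?_⟩
  · intro i
    by_cases h : 0 < w i (σ i)
    · have h' : 0 < w (σ i) i := by rwa [hsymm]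
      simp [h, hσ i, h']
    · simp [h]
  · intro i
    by_cases h : 0 < w i (σ i) <;> simp [h]
  · refine sum_congr rfl fun i _ => ?_
    by_cases h : 0 < w i (σ i)
    · simp [h, h.le]
    · simp [h, hdiag, not_lt.1 h]

/-- The weights separating `y` from all matchings by at least `δ`. -/
def sepWeights {I : Type*} [Fintype I] (y : I → I → ℝ) (δ : ℝ) : Set (I → I → ℝ) :=
  {w | (∀ i j, 0 ≤ w i j) ∧ (∀ i j, w i j = w j i) ∧ (∀ i, w i i = 0) ∧
    ∀ σ : I → I, Function.Involutive σ → ∑ i, w i (σ i) + δ ≤ ∑ i, ∑ j, w i j * y i j}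

lemma isClosed_sepWeights {I : Type*} [Fintype I] (y : I → I → ℝ) (δ : ℝ) :
    IsClosed (sepWeights y δ) := by
  simp only [sepWeights, Set.ofPred_and, Set.ofPred_forall]
  refine IsClosed.inter ?_ (IsClosed.inter ?_ (IsClosed.inter ?_ ?_))
  · exact isClosed_iInter fun i => isClosed_iInter fun j =>
      isClosed_le (by fun_prop) (by fun_prop)
  · exact isClosed_iInter fun i => isClosed_iInter fun j =>
      isClosed_eq (by fun_prop) (by fun_prop)
  · exact isClosed_iInter fun i => isClosed_eq (by fun_prop) (by fun_prop)
  · exact isClosed_iInter fun σ => isClosed_iInter fun _ =>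
      isClosed_le (by fun_prop) (by fun_prop)

lemma exists_minimal_sepWeights {I : Type*} [Fintype I] {y : I → I → ℝ} {δ : ℝ}
    (hne : (sepWeights y δ).Nonempty) :
    ∃ w ∈ sepWeights y δ, ∀ w' ∈ sepWeights y δ, ∑ i, ∑ j, w i j ≤ ∑ i, ∑ j, w' i j := by
  obtain ⟨w₀, hw₀⟩ := hne
  set R := ∑ i, ∑ j, w₀ i j
  have hcl : IsClosed (sepWeights y δ ∩ {w | ∑ i, ∑ j, w i j ≤ R}) :=
    (isClosed_sepWeights y δ).inter (isClosed_le (by fun_prop) (by fun_prop))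
  have hcomp : IsCompact (sepWeights y δ ∩ {w | ∑ i, ∑ j, w i j ≤ R}) := by
    refine IsCompact.of_isClosed_subset (isCompact_Icc (a := (0 : I → I → ℝ)) (b := fun _ _ => R))
      hcl ?_
    rintro w ⟨hw, hR⟩
    refine ⟨fun i j => hw.1 i j, fun i j => ?_⟩
    calc w i j ≤ ∑ j, w i j := single_le_sum (fun j _ => hw.1 i j) (mem_univ j)
      _ ≤ ∑ i, ∑ j, w i j :=
        single_le_sum (f := fun i => ∑ j, w i j) (fun i _ => sum_nonneg fun j _ => hw.1 i j)
          (mem_univ i)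
      _ ≤ R := hR
  obtain ⟨w, hw, hmin⟩ := hcomp.exists_isMinOn (f := fun w : I → I → ℝ => ∑ i, ∑ j, w i j)
    ⟨w₀, hw₀, le_refl R⟩ (by fun_prop)
  refine ⟨w, hw.1, fun w' hw' => ?_⟩
  rcases le_total (∑ i, ∑ j, w' i j) R with h | h
  · exact hmin ⟨hw', h⟩
  · exact le_trans hw.2 h

/-- A separating weight can be lowered uniformly on a set `D` of edges of positive weight,
provided every tight matching uses enough edges of `D`. -/
lemma exists_smaller_sepWeights {I : Type*} [Fintype I] {y w : I → I → ℝ} {δ : ℝ}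
    (hw : w ∈ sepWeights y δ) (D : I → I → Prop) [DecidableRel D]
    (hDsymm : ∀ i j, D i j → D j i) (hDpos : ∀ i j, D i j → 0 < w i j) (hDne : ∃ i j, D i j)
    (hD : ∀ σ : I → I, Function.Involutive σ → (∀ i, σ i ≠ i → 0 < w i (σ i)) →
      ∑ i, w i (σ i) + δ = ∑ i, ∑ j, w i j * y i j →
      ∑ i, ∑ j, (if D i j then y i j else 0) ≤ ∑ i, if D i (σ i) then (1 : ℝ) else 0) :
    ∃ w' ∈ sepWeights y δ, ∑ i, ∑ j, w' i j < ∑ i, ∑ j, w i j := by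
  classical
  obtain ⟨hpos, hsymm, hdiag, hsep⟩ := hw
  have hnn : ∀ᶠ ε : ℝ in nhdsWithin 0 (Set.Ioi 0), ∀ i j, D i j → ε < w i j := by
    simp only [Filter.eventually_all]
    intro i j h
    exact nhdsWithin_le_nhds (eventually_lt_nhds (hDpos i j h))
  have hmat : ∀ᶠ ε : ℝ in nhdsWithin 0 (Set.Ioi 0), ∀ σ : I → I, Function.Involutive σ →
      (∀ i, σ i ≠ i → 0 < w i (σ i)) →
      ∑ i, w i (σ i) - ε * (∑ i, if D i (σ i) then (1 : ℝ) else 0) + δ ≤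
      ∑ i, ∑ j, w i j * y i j - ε * ∑ i, ∑ j, (if D i j then y i j else 0) := by
    simp only [Filter.eventually_all]
    intro σ hσ hsup
    rcases (hsep σ hσ).lt_or_eq with hlt | heq
    · have : ∀ᶠ ε : ℝ in nhds 0,
          ∑ i, w i (σ i) - ε * (∑ i, if D i (σ i) then (1 : ℝ) else 0) + δ <
          ∑ i, ∑ j, w i j * y i j - ε * ∑ i, ∑ j, (if D i j then y i j else 0) := by
        apply Filter.Tendsto.eventually_lt (Continuous.tendsto (by fun_prop) 0)
          (Continuous.tendsto (by fun_prop) 0)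
        simpa using hlt
      exact nhdsWithin_le_nhds (this.mono fun _ h => h.le)
    · filter_upwards [self_mem_nhdsWithin] with ε hε
      have := mul_le_mul_of_nonneg_left (hD σ hσ hsup heq) (le_of_lt hε)
      linarith
  obtain ⟨ε, hε1, hε2, hε⟩ := (hnn.and (hmat.and self_mem_nhdsWithin)).exists
  replace hε : 0 < ε := hε
  have hDs : ∀ i j, D i j ↔ D j i := fun i j => ⟨hDsymm i j, hDsymm j i⟩
  set w' : I → I → ℝ := fun i j => w i j - ε * (if D i j then 1 else 0) with hw'
  have hw'nn : ∀ i j, 0 ≤ w' i j := by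
    intro i j
    by_cases h : D i j
    · simp [hw', h, (hε1 i j h).le]
    · simp [hw', h, hpos i j]
  have hw's : ∀ i j, w' i j = w' j i := by
    intro i j
    simp only [hw', hsymm i j, hDs i j]
  have hw'd : ∀ i, w' i i = 0 := by
    intro i
    have : ¬ D i i := fun h => by simpa [hdiag] using hDpos i i h
    simp [hw', this, hdiag]
  refine ⟨w', ⟨hw'nn, hw's, hw'd, fun σ hσ => ?_⟩, ?_⟩
  · obtain ⟨τ, hτ, hτs, hτw⟩ := exists_supported_involution hw's hw'd hσ
    have h1 := hε2 τ hτ fun i hi => lt_of_lt_of_le (hτs i hi) (by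
      simp only [hw']
      split_ifs <;> linarith)
    have h2 : ∑ i, w' i (σ i) = ∑ i, w' i (τ i) := by
      rw [hτw]
      exact sum_congr rfl fun i _ => (max_eq_right (hw'nn _ _)).symm
    have h3 : ∑ i, w' i (τ i) =
        ∑ i, w i (τ i) - ε * (∑ i, if D i (τ i) then (1 : ℝ) else 0) := by
      simp only [hw', sum_sub_distrib, mul_sum]
    have h4 : ∑ i, ∑ j, w' i j * y i j = ∑ i, ∑ j, w i j * y i j -
        ε * ∑ i, ∑ j, (if D i j then y i j else 0) := by
      simp only [hw', mul_sum, ← sum_sub_distrib]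
      refine sum_congr rfl fun i _ => sum_congr rfl fun j _ => ?_
      split_ifs <;> ring
    rw [h2, h3, h4]
    exact h1
  · obtain ⟨a, b, hab⟩ := hDne
    have hle : ∀ i j, w' i j ≤ w i j := by
      intro i j
      simp only [hw']
      split_ifs <;> linarith
    refine sum_lt_sum (fun i _ => sum_le_sum fun j _ => hle i j) ⟨a, mem_univ a, ?_⟩
    refine sum_lt_sum (fun j _ => hle a j) ⟨b, mem_univ b, ?_⟩
    simp [hw', hab, hε]

/-- An involution that preserves a finite set without fixed points there forces even
cardinality. -/
lemma even_card_of_involutive {I : Type*} {σ : I → I} (hσ : Function.Involutive σ)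
    (A : Finset I) (hmaps : ∀ i ∈ A, σ i ∈ A) (hfix : ∀ i ∈ A, σ i ≠ i) : Even A.card := by
  have h : ∑ _i ∈ A, (1 : ZMod 2) = 0 :=
    sum_involution (fun i _ => σ i) (fun _ _ => by decide) (fun i hi _ => hfix i hi)
      hmaps (fun i _ => hσ i)
  rw [sum_const, nsmul_eq_mul, mul_one] at h
  exact (ZMod.natCast_eq_zero_iff_even).1 h

/-- The matching polytope theorem of Edmonds, in the form that no weight separates a point satisfying
the degree and odd-set inequalities from all matchings. -/
theorem sepWeights_eq_empty {I : Type*} [Fintype I] {y : I → I → ℝ} {δ : ℝ} (hδ : 0 < δ)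
    (hy : ∀ i j, 0 ≤ y i j) (hysymm : ∀ i j, y i j = y j i) (hdeg : ∀ i, ∑ j, y i j ≤ 1)
    (hodd : ∀ S : Finset I, ∑ i ∈ S, ∑ j ∈ S, y i j ≤ ((2 * (S.card / 2) : ℕ) : ℝ)) :
    sepWeights y δ = ∅ := by
  classical
  by_contra hne
  obtain ⟨w, hw, hmin⟩ := exists_minimal_sepWeights (Set.nonempty_iff_ne_empty.2 hne)
  obtain ⟨hpos, hsymm, hdiag, hsep⟩ := id hw
  set c := ∑ i, ∑ j, w i j * y i j - δ with hc
  have hle : ∀ σ : I → I, Function.Involutive σ → ∑ i, w i (σ i) ≤ c := fun σ hσ => by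
    linarith [hsep σ hσ]
  have hcontra : ∀ (D : I → I → Prop) [DecidableRel D], (∀ i j, D i j → D j i) → (∀ i j, D i j → 0 < w i j) →
      (∃ i j, D i j) → ¬ ∀ σ : I → I, Function.Involutive σ → (∀ i, σ i ≠ i → 0 < w i (σ i)) →
      ∑ i, w i (σ i) = c →
      ∑ i, ∑ j, (if D i j then y i j else 0) ≤ ∑ i, if D i (σ i) then (1 : ℝ) else 0 := by
    intro D _ h1 h2 h3 h4
    obtain ⟨w', hw', hlt⟩ := exists_smaller_sepWeights hw D h1 h2 h3
      fun σ hσ hs hc' => h4 σ hσ hs (by linarith)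
    exact absurd (hmin w' hw') (not_le.2 hlt)
  -- every vertex with an edge of positive weight is missed by some tight matching
  have hmiss : ∀ v b, 0 < w v b → ∃ σ : I → I, Function.Involutive σ ∧
      (∀ i, σ i ≠ i → 0 < w i (σ i)) ∧ ∑ i, w i (σ i) = c ∧ σ v = v := by
    intro v b hvb
    by_contra! hcov
    refine hcontra (fun i j => 0 < w i j ∧ (i = v ∨ j = v)) ?_ (fun i j h => h.1)
      ⟨v, b, hvb, Or.inl rfl⟩ ?_
    · rintro i j ⟨h, h'⟩
      exact ⟨by rwa [hsymm], h'.symm⟩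
    · intro σ hσ hs hσc
      have hv := hcov σ hσ hs hσc
      have hpv := hs v hv
      have h1 : ∑ i, ∑ j, (if 0 < w i j ∧ (i = v ∨ j = v) then y i j else 0) ≤ 2 := by
        calc _ ≤ ∑ i, ∑ j, ((if i = v then y i j else 0) + (if j = v then y i j else 0)) := by
              refine sum_le_sum fun i _ => sum_le_sum fun j _ => ?_
              have := hy i j
              split_ifs <;> first | linarith | tauto
          _ = ∑ j, y v j + ∑ i, y i v := by
              simp only [sum_add_distrib]
              congr 1
              · rw [sum_comm]; simp
              · simp
          _ ≤ 2 := by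
              have := hdeg v
              have h' : ∑ i, y i v = ∑ i, y v i := sum_congr rfl fun i _ => hysymm i v
              linarith
      refine h1.trans ?_
      have h2 : ∑ i ∈ ({v, σ v} : Finset I),
          (if 0 < w i (σ i) ∧ (i = v ∨ σ i = v) then (1 : ℝ) else 0) = 2 := by
        rw [sum_pair hv.symm]
        have : 0 < w (σ v) v := by rwa [hsymm]
        simp [hσ v, hpv, this]
        norm_num
      rw [← h2]
      exact sum_le_sum_of_subset_of_nonneg (subset_univ _) fun i _ _ => by
        split_ifs <;> norm_num
  -- there is an edge of positive weight
  obtain ⟨u, u', huu⟩ : ∃ u u', 0 < w u u' := by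
    by_contra! h
    have h0 : ∀ i j, w i j = 0 := fun i j => le_antisymm (h i j) (hpos i j)
    have := hsep id (fun _ => rfl)
    simp [h0] at this
    linarith
  set T : Set (I → I) := {σ | Function.Involutive σ ∧ (∀ i, σ i ≠ i → 0 < w i (σ i)) ∧
    ∑ i, w i (σ i) = c} with hT
  have htrans : ∀ a t b, a ≠ b → (∃ σ ∈ T, σ t = t) → (∀ σ ∈ T, σ t = t → σ a ≠ a) →
      (∀ σ ∈ T, σ t = t → σ b ≠ b) → ∀ σ ∈ T, σ a = a → σ b ≠ b := by
    rintro a t b hab ⟨N, ⟨hN, hNs, hNc⟩, ht⟩ ha hb M ⟨hM, hMs, hMc⟩ hMa hMb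
    obtain ⟨σ, h1, h2, h3, h4, h5⟩ :=
      exists_maximal_fixing_both hle hM hN hMs hNs hMc hNc ht hMa hMb hab
    rcases h5 with h5 | h5
    · exact ha σ ⟨h1, h2, h3⟩ h4 h5
    · exact hb σ ⟨h1, h2, h3⟩ h4 h5
  have hadj : ∀ a b, 0 < w a b → ∀ σ ∈ T, σ a = a → σ b ≠ b := by
    rintro a b hab σ ⟨hσ, hs, hσc⟩ ha hb
    have hne : a ≠ b := by rintro rfl; simp [hdiag] at hab
    have hinv : Function.Involutive fun i => if i = a then b else if i = b then a else σ i := by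
      intro i
      by_cases h1 : i = a
      · simp [h1, hne.symm]
      by_cases h2 : i = b
      · simp [h2, hne.symm]
      have h3 : σ i ≠ a := fun h => h1 (by rw [← hσ i, h, ha])
      have h4 : σ i ≠ b := fun h => h2 (by rw [← hσ i, h, hb])
      simp [h1, h2, h3, h4, hσ i]
    have hlt : ∑ i, w i (σ i) < ∑ i, w i (if i = a then b else if i = b then a else σ i) := by
      refine sum_lt_sum (fun i _ => ?_) ⟨a, mem_univ a, by simp [ha, hdiag, hab]⟩
      by_cases h1 : i = a
      · simp [h1, ha, hdiag, hpos]
      by_cases h2 : i = b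
      · simp [h2, hb, hdiag, hpos, hne.symm]
      simp [h1, h2]
    rw [hσc] at hlt
    exact absurd (hle _ hinv) (not_le.2 hlt)
  set S : Finset I := univ.filter fun v => v = u ∨ ∀ σ ∈ T, σ u = u → σ v ≠ v with hS
  have huS : u ∈ S := by simp [hS]
  have hmissT : ∀ v b, 0 < w v b → ∃ σ ∈ T, σ v = v := fun v b h => by
    obtain ⟨σ, h1, h2, h3, h4⟩ := hmiss v b h
    exact ⟨σ, ⟨h1, h2, h3⟩, h4⟩
  have hSclosed : ∀ a b, 0 < w a b → a ∈ S → b ∈ S := by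
    intro a b hab ha
    simp only [hS, mem_filter, mem_univ, true_and] at ha ⊢
    by_cases hbu : b = u
    · exact Or.inl hbu
    right
    rcases ha with rfl | ha
    · exact hadj a b hab
    · exact htrans u a b (Ne.symm hbu) (hmissT a b hab)
        (fun σ hσ h h' => ha σ hσ h' h) (hadj a b hab)
  have hSmiss : ∀ σ ∈ T, ∀ a ∈ S, ∀ b ∈ S, σ a = a → σ b = b → a = b := by
    intro σ hσ a ha b hb h1 h2
    simp only [hS, mem_filter, mem_univ, true_and] at ha hb
    by_contra hab
    rcases ha with rfl | ha
    · rcases hb with rfl | hb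
      · exact hab rfl
      · exact hb σ hσ h1 h2
    · rcases hb with rfl | hb
      · exact ha σ hσ h2 h1
      · exact htrans a u b hab (hmissT u u' huu) ha hb σ hσ h1 h2
  refine hcontra (fun i j => 0 < w i j ∧ i ∈ S ∧ j ∈ S) ?_ (fun i j h => h.1)
    ⟨u, u', huu, huS, hSclosed u u' huu huS⟩ ?_
  · rintro i j ⟨h1, h2, h3⟩
    exact ⟨by rwa [hsymm], h3, h2⟩
  · intro σ hσ hs hσc
    have hσT : σ ∈ T := ⟨hσ, hs, hσc⟩
    calc ∑ i, ∑ j, (if 0 < w i j ∧ i ∈ S ∧ j ∈ S then y i j else 0)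
        ≤ ∑ i, ∑ j, (if i ∈ S then (if j ∈ S then y i j else 0) else 0) := by
          refine sum_le_sum fun i _ => sum_le_sum fun j _ => ?_
          have := hy i j
          split_ifs <;> tauto
      _ = ∑ i ∈ S, ∑ j ∈ S, y i j := by
          rw [← sum_subset (subset_univ S) fun i _ hi => by simp [hi]]
          refine sum_congr rfl fun i hi => ?_
          simp [hi]
      _ ≤ ((2 * (S.card / 2) : ℕ) : ℝ) := hodd S
      _ ≤ ((S.filter fun i => σ i ≠ i).card : ℝ) := by
          have hfix : (S.filter fun i => σ i = i).card ≤ 1 := by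
            refine card_le_one.2 fun a ha b hb => ?_
            rw [mem_filter] at ha hb
            exact hSmiss σ hσT a ha.1 b hb.1 ha.2 hb.2
          have hsum := card_filter_add_card_filter_not (s := S) fun i => σ i = i
          have heven : Even (S.filter fun i => σ i ≠ i).card := by
            refine even_card_of_involutive hσ _ (fun i hi => ?_) fun i hi => (mem_filter.1 hi).2
            rw [mem_filter] at hi ⊢
            exact ⟨hSclosed i _ (hs i hi.2) hi.1, fun h => hi.2 (by rw [← hσ i, h, h])⟩
          obtain ⟨k, hk⟩ := heven
          norm_cast
          simp only [ne_eq] at hk hsum ⊢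
          omega
      _ = ∑ i, if σ i ≠ i ∧ i ∈ S then (1 : ℝ) else 0 := by
          rw [sum_boole]
          congr 2
          ext i
          simp [and_comm]
      _ ≤ ∑ i, if 0 < w i (σ i) ∧ i ∈ S ∧ σ i ∈ S then (1 : ℝ) else 0 := by
          refine sum_le_sum fun i _ => ?_
          by_cases h : σ i ≠ i ∧ i ∈ S
          · rw [if_pos h, if_pos ⟨hs i h.1, h.2, hSclosed i _ (hs i h.1) h.2⟩]
          · rw [if_neg h]
            split_ifs <;> norm_num

/-- The matching number is at most half the number of available vertices. -/
lemma two_mul_kF_le {I : Type*} [Fintype I] [DecidableEq I] {F : Finset (I × I)} {S : Finset I}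
    (hF : ∀ e ∈ F, e.1 ∈ S ∧ e.2 ∈ S ∧ e.1 ≠ e.2) : 2 * kF F ≤ S.card := by
  classical
  suffices h : kF F ≤ S.card / 2 by omega
  unfold kF
  refine Finset.sup_le fun M hM => ?_
  rw [mem_filter, mem_powerset] at hM
  obtain ⟨hMF, hdisj⟩ := hM
  have hcard : (M.biUnion fun e => ({e.1, e.2} : Finset I)).card = M.card * 2 := by
    rw [card_biUnion, sum_const_nat]
    · exact fun e he => card_pair (hF e (hMF he)).2.2
    · intro e he e' he' hne
      obtain ⟨h1, h2, h3, h4⟩ := hdisj he he' hne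
      simp [h1.symm, Ne.symm h2, Ne.symm h3, Ne.symm h4]
  have hsub : (M.biUnion fun e => ({e.1, e.2} : Finset I)) ⊆ S := by
    refine biUnion_subset.2 fun e he => ?_
    have := hF e (hMF he)
    simp [insert_subset_iff, this.1, this.2.1]
  have := card_le_card hsub
  omega

lemma card_le_kF {I : Type*} [Fintype I] [DecidableEq I] {F M : Finset (I × I)} (hMF : M ⊆ F)
    (hM : ∀ e ∈ M, ∀ e' ∈ M, e ≠ e' → e.1 ≠ e'.1 ∧ e.1 ≠ e'.2 ∧ e.2 ≠ e'.1 ∧ e.2 ≠ e'.2) :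
    M.card ≤ kF F := by
  classical
  unfold kF
  refine Finset.le_sup (f := Finset.card) ?_
  rw [mem_filter, mem_powerset]
  exact ⟨hMF, fun e he e' he' hne => hM e he e' he' hne⟩

lemma MatchSet.eq_of_eq_one {I : Type*} [Fintype I] {m : I → I → ℝ} (hm : m ∈ MatchSet I)
    {i j k : I} (hj : m i j = 1) (hk : m i k = 1) : j = k := by
  classical
  by_contra hne
  have h := sum_le_sum_of_subset_of_nonneg (f := m i) (subset_univ {j, k}) fun l _ _ => by
    rcases hm.1 i l with h | h <;> simp [h]
  rw [sum_pair hne, hj, hk, hm.2.2 i] at h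
  norm_num at h

lemma MatchSet.sum_eq_card {I : Type*} [Fintype I] [DecidableEq I] {m : I → I → ℝ}
    (hm : m ∈ MatchSet I) (F : Finset (I × I)) :
    ∑ e ∈ F, m e.1 e.2 = ((F.filter fun e => m e.1 e.2 = 1).card : ℝ) := by
  classical
  rw [← sum_boole]
  refine sum_congr rfl fun e _ => ?_
  rcases hm.1 e.1 e.2 with h | h <;> simp [h]

lemma MatchSet.sum_le_kF {I : Type*} [Fintype I] [DecidableEq I] {m : I → I → ℝ}
    (hm : m ∈ MatchSet I) {F : Finset (I × I)} (hF : ∀ e ∈ F, (e.2, e.1) ∉ F) :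
    ∑ e ∈ F, m e.1 e.2 ≤ (kF F : ℝ) := by
  rw [MatchSet.sum_eq_card hm]
  refine Nat.cast_le.2 (card_le_kF (filter_subset _ _) ?_)
  rintro ⟨a, b⟩ he ⟨a', b'⟩ he' hne
  simp only [mem_filter] at he he'
  obtain ⟨heF, h1⟩ := he
  obtain ⟨heF', h1'⟩ := he'
  have h2 : m b a = 1 := by rwa [hm.2.1]
  have h2' : m b' a' = 1 := by rwa [hm.2.1]
  refine ⟨?_, ?_, ?_, ?_⟩ <;> (intro h; simp only at h; subst h)
  · exact hne (by rw [eq_of_eq_one hm h1 h1'])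
  · rw [eq_of_eq_one hm h1 h2'] at heF
    exact hF _ heF heF'
  · rw [eq_of_eq_one hm h2 h1'] at heF
    exact hF _ heF heF'
  · exact hne (by rw [eq_of_eq_one hm h2 h2'])

lemma MatchSet.sum_star_le_one {I : Type*} [Fintype I] [DecidableEq I] {m : I → I → ℝ}
    (hm : m ∈ MatchSet I) {i : I} {J : Finset (I × I)} (hJ : ∀ e ∈ J, e.1 = i ∨ e.2 = i)
    (hJ' : ∀ j, j ≠ i → ¬((i, j) ∈ J ∧ (j, i) ∈ J)) :
    ∑ e ∈ J, m e.1 e.2 ≤ 1 := by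
  rw [MatchSet.sum_eq_card hm]
  refine Nat.cast_le_one.2 (card_le_one.2 ?_)
  rintro ⟨a, b⟩ he ⟨a', b'⟩ he'
  simp only [mem_filter] at he he'
  obtain ⟨heF, h1⟩ := he
  obtain ⟨heF', h1'⟩ := he'
  have h2 : m b a = 1 := by rwa [hm.2.1]
  have h2' : m b' a' = 1 := by rwa [hm.2.1]
  rcases hJ _ heF with h | h <;> rcases hJ _ heF' with h' | h' <;> simp only at h h' <;>
    subst h <;> subst h'
  · rw [eq_of_eq_one hm h1 h1']
  · have key := eq_of_eq_one hm h1 h2'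
    rw [← key] at heF' ⊢
    by_cases hb : b = b'
    · rw [hb]
    · exact absurd ⟨heF, heF'⟩ (hJ' b hb)
  · have key := eq_of_eq_one hm h2 h1'
    rw [← key] at heF' ⊢
    by_cases hb : a = a'
    · rw [hb]
    · exact absurd ⟨heF', heF⟩ (hJ' a hb)
  · rw [eq_of_eq_one hm h2 h2']

lemma sum_le_of_mem_convexHull {I : Type*} [Fintype I] {A : Set (I → I → ℝ)} {x : I → I → ℝ}
    (hx : x ∈ convexHull ℝ A) (F : Finset (I × I)) {c : ℝ}
    (h : ∀ m ∈ A, ∑ e ∈ F, m e.1 e.2 ≤ c) : ∑ e ∈ F, x e.1 e.2 ≤ c := by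
  have hconv : Convex ℝ {x : I → I → ℝ | ∑ e ∈ F, x e.1 e.2 ≤ c} :=
    convex_halfSpace_le ⟨fun x y => by simp [sum_add_distrib], fun a x => by simp [mul_sum]⟩ c
  exact convexHull_min h hconv hx

/-- The 0-1 matrix of a map. -/
def matchMatrix {I : Type*} [DecidableEq I] (σ : I → I) : I → I → ℝ :=
  fun i j => if σ i = j then 1 else 0

lemma matchMatrix_mem_MatchSet {I : Type*} [Fintype I] [DecidableEq I] {σ : I → I}
    (hσ : Function.Involutive σ) : matchMatrix σ ∈ MatchSet I := by
  refine ⟨fun i j => ?_, fun i j => ?_, fun i => by simp [matchMatrix]⟩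
  · by_cases h : σ i = j <;> simp [matchMatrix, h]
  · have : σ i = j ↔ σ j = i := ⟨fun h => by rw [← h, hσ i], fun h => by rw [← h, hσ j]⟩
    simp [matchMatrix, this]

/-- A point satisfying the degree and odd-set inequalities, completed on the diagonal to row
sums one, is a convex combination of matchings. -/
theorem mem_convexHull_MatchSet {I : Type*} [Fintype I] [DecidableEq I] {y : I → I → ℝ}
    (hy : ∀ i j, 0 ≤ y i j) (hysymm : ∀ i j, y i j = y j i) (hsum : ∀ i, ∑ j, y i j = 1)
    (hodd : ∀ S : Finset I, ∑ i ∈ S, ∑ j ∈ S.erase i, y i j ≤ ((2 * (S.card / 2) : ℕ) : ℝ)) :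
    y ∈ convexHull ℝ (MatchSet I) := by
  classical
  set A : Set (I → I → ℝ) := matchMatrix '' {σ : I → I | Function.Involutive σ} with hA
  have hAsub : A ⊆ MatchSet I := by
    rintro _ ⟨σ, hσ, rfl⟩
    exact matchMatrix_mem_MatchSet hσ
  refine convexHull_mono hAsub ?_
  by_contra hnot
  have hfin : A.Finite := (Set.toFinite _).image _
  obtain ⟨f, s, hfs, hsy⟩ := geometric_hahn_banach_closed_point (convex_convexHull ℝ A)
    (hfin.isClosed_convexHull ℝ) hnot
  set c : I → I → ℝ := fun i j => f (Pi.single i (Pi.single j 1)) with hc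
  have hf : ∀ x : I → I → ℝ, f x = ∑ i, ∑ j, c i j * x i j := by
    intro x
    have hx : x = ∑ i, ∑ j, x i j • (Pi.single i (Pi.single j 1) : I → I → ℝ) := by
      ext a b
      simp [Finset.sum_apply, Pi.single_apply, ite_apply]
    conv_lhs => rw [hx]
    simp only [map_sum, map_smul, smul_eq_mul, hc, mul_comm]
  set d : I → I → ℝ := fun i j => (c i j + c j i - c i i - c j j) / 2 with hd
  have hds : ∀ i j, d i j = d j i := fun i j => by simp only [hd]; ring
  have hdd : ∀ i, d i i = 0 := fun i => by simp only [hd]; ring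
  have hval : ∀ x : I → I → ℝ, (∀ i j, x i j = x j i) → (∀ i, ∑ j, x i j = 1) →
      f x = ∑ i, c i i + ∑ i, ∑ j, d i j * x i j := by
    intro x hxs hx1
    have h1 : ∑ i, ∑ j, c j i * x i j = ∑ i, ∑ j, c i j * x i j := by
      rw [sum_comm]
      exact sum_congr rfl fun i _ => sum_congr rfl fun j _ => by rw [hxs]
    have h2 : ∑ i, ∑ j, c i i * x i j = ∑ i, c i i := by
      simp only [← mul_sum, hx1, mul_one]
    have h3 : ∑ i, ∑ j, c j j * x i j = ∑ i, c i i := by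
      rw [← h2, sum_comm]
      exact sum_congr rfl fun i _ => sum_congr rfl fun j _ => by rw [hxs]
    have h4 : ∑ i, ∑ j, d i j * x i j = (∑ i, ∑ j, c i j * x i j + ∑ i, ∑ j, c j i * x i j
        - ∑ i, ∑ j, c i i * x i j - ∑ i, ∑ j, c j j * x i j) / 2 := by
      simp only [← sum_add_distrib, ← sum_sub_distrib, sum_div]
      exact sum_congr rfl fun i _ => sum_congr rfl fun j _ => by simp only [hd]; ring
    rw [hf, h4, h1, h2, h3]
    ring
  set z : I → I → ℝ := fun i j => if i = j then 0 else y i j with hz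
  set δ : ℝ := f y - s with hδ
  have hempty : sepWeights z δ = ∅ := by
    refine sepWeights_eq_empty (by linarith) (fun i j => ?_) (fun i j => ?_) (fun i => ?_)
      fun S => ?_
    · simp only [hz]
      split_ifs <;> simp [hy]
    · simp only [hz, hysymm i j, eq_comm]
    · rw [← hsum i]
      refine sum_le_sum fun j _ => ?_
      simp only [hz]
      split_ifs <;> simp [hy]
    · refine le_trans (le_of_eq ?_) (hodd S)
      refine sum_congr rfl fun i hi => ?_
      rw [← sum_erase_add _ _ hi]
      simp only [hz, if_true, add_zero]
      exact sum_congr rfl fun j hj => if_neg (ne_of_mem_erase hj).symm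
  have hmem : (fun i j => max 0 (d i j)) ∈ sepWeights z δ := by
    refine ⟨fun i j => le_max_left _ _, fun i j => by simp only [hds i j],
      fun i => by simp [hdd], fun σ hσ => ?_⟩
    obtain ⟨τ, hτ, -, hτw⟩ := exists_supported_involution hds hdd hσ
    have hm := matchMatrix_mem_MatchSet hτ
    have h1 : f (matchMatrix τ) < s := hfs _ (subset_convexHull ℝ A ⟨τ, hτ, rfl⟩)
    rw [hval _ hm.2.1 hm.2.2] at h1
    have h2 : ∑ i, ∑ j, d i j * matchMatrix τ i j = ∑ i, d i (τ i) := by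
      simp [matchMatrix]
    have h3 : ∑ i, ∑ j, d i j * y i j ≤ ∑ i, ∑ j, max 0 (d i j) * z i j := by
      refine sum_le_sum fun i _ => sum_le_sum fun j _ => ?_
      by_cases hij : i = j
      · subst hij; simp [hdd]
      · simp only [hz, if_neg hij]
        exact mul_le_mul_of_nonneg_right (le_max_right _ _) (hy i j)
    have h4 := hval y hysymm hsum
    simp only [← hτw]
    linarith
  rw [hempty] at hmem
  exact hmem

/-- Every matrix admits a tournament choosing, for each pair of distinct indices, the larger of
the two transposed entries. -/
lemma exists_orientation {I : Type*} [Fintype I] [DecidableEq I] (x : I → I → ℝ) :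
    ∃ R : I → I → Prop, (∀ i, ¬ R i i) ∧ (∀ i j, i ≠ j → (R i j ↔ ¬ R j i)) ∧
      ∀ i j, R i j → max (x i j) (x j i) = x i j := by
  set e := Fintype.equivFin I
  refine ⟨fun i j => x j i < x i j ∨ (x j i = x i j ∧ e i < e j), fun i => by simp,
    fun i j hij => ?_, ?_⟩
  · have he : e i ≠ e j := fun h => hij (e.injective h)
    rcases lt_trichotomy (x i j) (x j i) with h | h | h
    · simp [h, h.not_gt, h.ne']
    · simp only [h, lt_self_iff_false, true_and, false_or, not_lt]
      exact ⟨fun h => h.le, fun h => lt_of_le_of_ne h he⟩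
    · simp [h, h.not_gt, h.ne']
  · rintro i j (h | h)
    · exact max_eq_left h.le
    · exact max_eq_left h.1.le

/-- The star at `i`, oriented by a relation `R`. -/
lemma exists_oriented_star {I : Type*} [Fintype I] [DecidableEq I] {R : I → I → Prop}
    [DecidableRel R] (i : I) :
    ∃ J : Finset (I × I), (∀ e ∈ J, e.1 = i ∨ e.2 = i) ∧ (i, i) ∈ J ∧
      (∀ j, j ≠ i → (((i, j) ∈ J ∨ (j, i) ∈ J) ∧ ¬((i, j) ∈ J ∧ (j, i) ∈ J))) ∧
      ∀ x : I → I → ℝ, ∑ e ∈ J, x e.1 e.2 = ∑ j, if R i j then x i j else x j i := by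
  set g : I → I × I := fun j => if R i j then (i, j) else (j, i) with hg
  have hginj : Function.Injective g := by
    intro j k hjk
    simp only [hg] at hjk
    split_ifs at hjk <;> rw [Prod.mk.injEq] at hjk
    · exact hjk.2
    · exact hjk.2.trans hjk.1
    · exact hjk.1.trans hjk.2
    · exact hjk.1
  refine ⟨univ.image g, ?_, ?_, ?_, fun x => ?_⟩
  · intro e he
    obtain ⟨j, -, rfl⟩ := mem_image.1 he
    simp only [hg]
    split_ifs <;> simp
  · exact mem_image.2 ⟨i, mem_univ i, by simp [hg]⟩
  · intro j hj
    have h1 : (i, j) ∈ univ.image g ↔ R i j := by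
      simp only [mem_image, mem_univ, true_and, hg]
      constructor
      · rintro ⟨k, hk⟩
        split_ifs at hk with hR <;> rw [Prod.mk.injEq] at hk
        · exact hk.2 ▸ hR
        · exact absurd hk.2.symm hj
      · exact fun h => ⟨j, if_pos h⟩
    have h2 : (j, i) ∈ univ.image g ↔ ¬ R i j := by
      simp only [mem_image, mem_univ, true_and, hg]
      constructor
      · rintro ⟨k, hk⟩
        split_ifs at hk with hR <;> rw [Prod.mk.injEq] at hk
        · exact absurd hk.1.symm hj
        · exact hk.1 ▸ hR
      · exact fun h => ⟨j, if_neg h⟩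
    rw [h1, h2]
    tauto
  · rw [sum_image hginj.injOn]
    refine sum_congr rfl fun j _ => ?_
    simp only [hg]
    split_ifs <;> rfl

theorem statement11 {I : Type*} [Fintype I] [DecidableEq I] [Nonempty I] :
    {x : I → I → ℝ | (∀ i j, 0 ≤ x i j) ∧
        ∃ x' ∈ convexHull ℝ (MatchSet I), ∀ i j, x i j ≤ x' i j}
      = (⋂ F ∈ {F : Finset (I × I) | F.Nonempty ∧ (∀ i : I, (i, i) ∉ F) ∧
            ∀ e ∈ F, (e.2, e.1) ∉ F},
          {x : I → I → ℝ | (∀ i j, 0 ≤ x i j) ∧ ∑ e ∈ F, x e.1 e.2 ≤ (kF F : ℝ)})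
        ∩ (⋂ i : I, ⋂ J ∈ {J : Finset (I × I) | (∀ e ∈ J, e.1 = i ∨ e.2 = i) ∧
              (i, i) ∈ J ∧ ∀ j : I, j ≠ i →
                (((i, j) ∈ J ∨ (j, i) ∈ J) ∧ ¬((i, j) ∈ J ∧ (j, i) ∈ J))},
            {x : I → I → ℝ | (∀ i j, 0 ≤ x i j) ∧ ∑ e ∈ J, x e.1 e.2 ≤ 1}) := by
  classical
  ext x
  simp only [Set.mem_inter_iff, Set.mem_iInter, Set.mem_ofPred_eq]
  constructor
  · rintro ⟨hx, x', hx', hle⟩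
    refine ⟨fun F hF => ⟨hx, ?_⟩, fun i J hJ => ⟨hx, ?_⟩⟩
    · exact (sum_le_sum fun e _ => hle e.1 e.2).trans
        (sum_le_of_mem_convexHull hx' F fun m hm => MatchSet.sum_le_kF hm hF.2.2)
    · exact (sum_le_sum fun e _ => hle e.1 e.2).trans
        (sum_le_of_mem_convexHull hx' J fun m hm =>
          MatchSet.sum_star_le_one hm hJ.1 fun j hj => (hJ.2.2 j hj).2)
  · rintro ⟨hF, hJ⟩
    obtain ⟨R, hirr, htot, hmax⟩ := exists_orientation x
    set y : I → I → ℝ := fun i j => max (x i j) (x j i) with hy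
    have hys : ∀ i j, y i j = y j i := fun i j => max_comm _ _
    have hstar : ∀ i, (∀ a b, 0 ≤ x a b) ∧ x i i + ∑ j ∈ univ.erase i, y i j ≤ 1 := by
      intro i
      obtain ⟨J, hJ1, hJ2, hJ3, hsum⟩ := exists_oriented_star (R := R) i
      have h := hJ i J ⟨hJ1, hJ2, hJ3⟩
      refine ⟨h.1, le_trans (le_of_eq ?_) h.2⟩
      rw [hsum, ← add_sum_erase _ _ (mem_univ i), ite_self]
      congr 1
      refine sum_congr rfl fun j hj => ?_
      have hij := (ne_of_mem_erase hj).symm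
      split_ifs with hR
      · exact hmax i j hR
      · rw [hys]
        exact hmax j i ((htot j i hij.symm).2 hR)
    have hx : ∀ i j, 0 ≤ x i j := (hstar (Classical.arbitrary I)).1
    have hy0 : ∀ i j, 0 ≤ y i j := fun i j => le_max_of_le_left (hx i j)
    have hodd : ∀ S : Finset I,
        ∑ i ∈ S, ∑ j ∈ S.erase i, y i j ≤ ((2 * (S.card / 2) : ℕ) : ℝ) := by
      intro S
      set F : Finset (I × I) := (S ×ˢ S).filter fun e => R e.1 e.2 with hFdef
      have hsumF : ∑ i ∈ S, ∑ j ∈ S.erase i, y i j = 2 * ∑ e ∈ F, x e.1 e.2 := by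
        have h1 : ∑ e ∈ F, x e.1 e.2 = ∑ i ∈ S, ∑ j ∈ S, if R i j then y i j else 0 := by
          rw [hFdef, sum_filter, sum_product]
          refine sum_congr rfl fun i _ => sum_congr rfl fun j _ => ?_
          by_cases h : R i j
          · simp [h, hy, hmax i j h]
          · simp [h]
        have h2 : ∑ i ∈ S, ∑ j ∈ S, (if R i j then y i j else 0) =
            ∑ i ∈ S, ∑ j ∈ S, (if R j i then y i j else 0) := by
          rw [sum_comm]
          exact sum_congr rfl fun i _ => sum_congr rfl fun j _ => by rw [hys]
        rw [two_mul, h1]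
        nth_rewrite 2 [h2]
        rw [← sum_add_distrib]
        refine sum_congr rfl fun i hi => ?_
        rw [← sum_add_distrib, ← sum_erase_add _ _ hi]
        simp only [hirr, if_false, add_zero]
        refine sum_congr rfl fun j hj => ?_
        have := htot i j (ne_of_mem_erase hj).symm
        by_cases h : R j i <;> simp [this, h]
      have hFk : ∑ e ∈ F, x e.1 e.2 ≤ (kF F : ℝ) := by
        rcases F.eq_empty_or_nonempty with h | h
        · rw [h]; simp
        · refine (hF F ⟨h, fun i hi => hirr i (mem_filter.1 hi).2, fun e he he' => ?_⟩).2
          have h1 := (mem_filter.1 he).2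
          have h2 : R e.2 e.1 := (mem_filter.1 he').2
          exact (htot e.1 e.2 fun h => hirr e.1 (by rw [← h] at h1; exact h1)).1 h1 h2
      have hk : 2 * kF F ≤ S.card := two_mul_kF_le fun e he => by
        rw [hFdef, mem_filter, mem_product] at he
        exact ⟨he.1.1, he.1.2, fun h => hirr e.1 (by have := he.2; rw [← h] at this; exact this)⟩
      have hk' : ((2 * kF F : ℕ) : ℝ) ≤ ((2 * (S.card / 2) : ℕ) : ℝ) := by
        exact Nat.cast_le.2 (by omega)
      rw [hsumF]
      refine le_trans ?_ hk'
      push_cast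
      linarith
    refine ⟨hx, fun i j => if i = j then 1 - ∑ k ∈ univ.erase i, y i k else y i j,
      mem_convexHull_MatchSet (fun i j => ?_) (fun i j => ?_) (fun i => ?_) (fun S => ?_),
      fun i j => ?_⟩
    · by_cases h : i = j
      · simp only [h, if_true]
        linarith [(hstar j).2, hx j j]
      · simp only [h, if_false, hy0]
    · by_cases h : i = j
      · simp [h]
      · simp only [h, Ne.symm h, if_false, hys i j]
    · rw [← add_sum_erase _ _ (mem_univ i), if_pos rfl]
      have : ∑ j ∈ univ.erase i, (if i = j then 1 - ∑ k ∈ univ.erase i, y i k else y i j) =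
          ∑ j ∈ univ.erase i, y i j :=
        sum_congr rfl fun j hj => if_neg (ne_of_mem_erase hj).symm
      rw [this]
      ring
    · refine le_trans (le_of_eq ?_) (hodd S)
      exact sum_congr rfl fun i _ => sum_congr rfl fun j hj =>
        if_neg (ne_of_mem_erase hj).symm
    · by_cases h : i = j
      · subst h
        simp only [if_true]
        linarith [(hstar i).2]
      · simp only [h, if_false]
        exact le_max_left _ _
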